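/- arXiv:0902.0054 — 4 statements merged into one kernel-verified Lean document; each statement's English description precedes it below -/
import Mathlib

section
/- For every real λ > 1/2 and every real z > 2, ∫_{-2}^{2} (z-x)^{-λ} (4-x²)^{λ-3/2} dx = 4^{2λ-2} (Γ(λ-1/2)²/Γ(2λ-1)) · G(z)^{λ-1} / √(z²-4), where G(z) = (z - √(z²-4))/2. -/
open MeasureTheory Set

lemma aux_beta (a : ℝ) (ha : 0 < a) :
    IntervalIntegrable (fun s : ℝ => s ^ (a - 1) * (1 - s) ^ (a - 1)) volume 0 1 ∧
    ∫ s in (0 : ℝ)..1, s ^ (a - 1) * (1 - s) ^ (a - 1) =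
      Real.Gamma a ^ 2 / Real.Gamma (2 * a) := by
  have hre : 0 < (a : ℂ).re := by simpa using ha
  have key : ∀ s ∈ Icc (0 : ℝ) 1, (s : ℂ) ^ ((a : ℂ) - 1) * (1 - (s : ℂ)) ^ ((a : ℂ) - 1)
      = ((s ^ (a - 1) * (1 - s) ^ (a - 1) : ℝ) : ℂ) := by
    intro s hs
    have h1 : 0 ≤ 1 - s := by linarith [hs.2]
    rw [Complex.ofReal_mul, Complex.ofReal_cpow hs.1, Complex.ofReal_cpow h1]
    push_cast
    rfl
  have hI := Complex.betaIntegral_convergent hre hre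
  have hI2 : IntervalIntegrable (fun s : ℝ => ((s ^ (a - 1) * (1 - s) ^ (a - 1) : ℝ) : ℂ))
      volume 0 1 := by
    refine hI.congr ?_
    intro s hs
    rw [uIoc_of_le zero_le_one] at hs
    exact key s ⟨hs.1.le, hs.2⟩
  constructor
  · rw [intervalIntegrable_iff] at hI2 ⊢
    have h := hI2.re
    simp only [RCLike.ofReal_re, RCLike.re_to_complex, Complex.ofReal_re] at h
    exact h
  · have h := Complex.betaIntegral_eq_Gamma_mul_div (a : ℂ) a hre hre
    rw [Complex.betaIntegral, intervalIntegral.integral_congr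
      (g := fun s : ℝ => ((s ^ (a - 1) * (1 - s) ^ (a - 1) : ℝ) : ℂ))
      (by intro s hs; rw [uIcc_of_le zero_le_one] at hs; exact key s hs),
      intervalIntegral.integral_ofReal, ← Complex.ofReal_add,
      Complex.Gamma_ofReal, Complex.Gamma_ofReal] at h
    rw [two_mul, sq]
    exact_mod_cast h

lemma aux_beta2 (a : ℝ) (ha : 0 < a) :
    IntervalIntegrable (fun x : ℝ => (4 - x ^ 2) ^ (a - 1)) volume (-2) 2 ∧
    ∫ x in (-2 : ℝ)..2, (4 - x ^ 2) ^ (a - 1) =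
      (4 : ℝ) ^ (2 * a - 1) * (Real.Gamma a ^ 2 / Real.Gamma (2 * a)) := by
  obtain ⟨h1, h2⟩ := aux_beta a ha
  have h3 := h1.comp_mul_right (c := 1 / 4) |>.comp_add_right 2
  have key : ∀ x ∈ Icc (-2 : ℝ) 2, (4 - x ^ 2) ^ (a - 1) = (16 : ℝ) ^ (a - 1) *
     ((1 / 4 * x + 1 / 2) ^ (a - 1) * (1 - (1 / 4 * x + 1 / 2)) ^ (a - 1)) := by
    intro x hx
    rw [← Real.mul_rpow (by linarith [hx.1]) (by linarith [hx.2]),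
      ← Real.mul_rpow (by norm_num) (mul_nonneg (by linarith [hx.1]) (by linarith [hx.2]))]
    congr 1; ring
  constructor
  · have h4 := h3.const_mul ((16 : ℝ) ^ (a - 1))
    norm_num at h4
    refine h4.congr ?_
    intro x hx
    rw [uIoc_of_le (by norm_num)] at hx
    simp only []
    rw [key x ⟨hx.1.le, hx.2⟩]
    ring_nf
  · rw [intervalIntegral.integral_congr
      (g := fun x : ℝ => (16 : ℝ) ^ (a - 1) *
     ((1 / 4 * x + 1 / 2) ^ (a - 1) * (1 - (1 / 4 * x + 1 / 2)) ^ (a - 1)))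
      (by intro s hs; rw [uIcc_of_le (by norm_num)] at hs; exact key s hs),
      intervalIntegral.integral_const_mul,
      intervalIntegral.integral_comp_mul_add (fun s : ℝ => s ^ (a - 1) * (1 - s) ^ (a - 1))
        (by norm_num : (1 / 4 : ℝ) ≠ 0)]
    norm_num
    rw [h2, show (16 : ℝ) = 4 ^ (2 : ℝ) by norm_num, ← Real.rpow_mul (by norm_num), ← mul_assoc]
    congr 1
    rw [show 2 * a - 1 = 2 * (a - 1) + 1 by ring, Real.rpow_add (by norm_num), Real.rpow_one]

lemma aux_w (r y : ℝ) (hr : 0 < r) (hr1 : r < 1) :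
    0 < √(1 - r ^ 2 + (r * y / 2) ^ 2) ∧
    √(1 - r ^ 2 + (r * y / 2) ^ 2) ^ 2 = 1 - r ^ 2 + (r * y / 2) ^ 2 ∧
    0 < √(1 - r ^ 2 + (r * y / 2) ^ 2) - r * y / 2 := by
  have h0 : 0 < 1 - r ^ 2 := by nlinarith
  have h1 : 0 < 1 - r ^ 2 + (r * y / 2) ^ 2 := by positivity
  refine ⟨Real.sqrt_pos.2 h1, Real.sq_sqrt h1.le, ?_⟩
  rw [sub_pos]
  apply Real.lt_sqrt_of_sq_lt
  linarith

lemma aux_main (l r : ℝ) (hl : 1 / 2 < l) (hr : 0 < r) (hr1 : r < 1) :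
    ∫ x in (-2 : ℝ)..2, (r + 1 / r - x) ^ (-l) * (4 - x ^ 2) ^ (l - 3 / 2) =
      r ^ l / (1 - r ^ 2) * ∫ x in (-2 : ℝ)..2, (4 - x ^ 2) ^ (l - 3 / 2) := by
  have h0 : 0 < 1 - r ^ 2 := by nlinarith
  set w : ℝ → ℝ := fun y => √(1 - r ^ 2 + (r * y / 2) ^ 2) with hw
  have hwp : ∀ y, 0 < w y := fun y => (aux_w r y hr hr1).1
  have hws : ∀ y, w y ^ 2 = 1 - r ^ 2 + (r * y / 2) ^ 2 := fun y => (aux_w r y hr hr1).2.1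
  have hwd : ∀ y, 0 < w y - r * y / 2 := fun y => (aux_w r y hr hr1).2.2
  set f : ℝ → ℝ := fun y => y * w y + 2 * r * (1 - y ^ 2 / 4) with hf
  have hwc : Continuous w := by rw [hw]; fun_prop
  have hder : ∀ y, HasDerivAt f ((w y - r * y / 2) ^ 2 / w y) y := by
    intro y
    have e1 : HasDerivAt (fun y : ℝ => 1 - r ^ 2 + (r * y / 2) ^ 2) (r ^ 2 * y / 2) y := by
      have := ((((hasDerivAt_id y).const_mul r).div_const 2).pow 2).const_add (1 - r ^ 2)
      convert! this using 1
      simp; ring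
    have e2 := e1.sqrt (by rw [← hws]; exact (pow_pos (hwp y) 2).ne')
    have e3 := ((hasDerivAt_id y).mul e2).add
      (((((hasDerivAt_id y).pow 2).div_const 4).const_sub 1).const_mul (2 * r))
    convert! e3 using 1
    have := (hwp y).ne'
    change _ = 1 * w y + id y * (r ^ 2 * y / 2 / (2 * w y)) + _
    simp
    field_simp
    ring
  have hpos : ∀ y, 0 < (w y - r * y / 2) ^ 2 / w y :=
    fun y => div_pos (pow_pos (hwd y) 2) (hwp y)
  have hmono : StrictMono f := strictMono_of_deriv_pos fun y => by
    rw [(hder y).deriv]; exact hpos y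
  have hfc : Continuous f := by rw [hf]; fun_prop
  have hf2 : f 2 = 2 := by
    have : w 2 = 1 := by simp [hw]
    simp only [hf, this]; norm_num
  have hfm2 : f (-2) = -2 := by
    have : w (-2) = 1 := by
      simp only [hw]
      rw [Real.sqrt_eq_one]
      ring
    simp only [hf, this]; norm_num
  have himg : f '' Ioo (-2) 2 = Ioo (-2) 2 := by
    apply Subset.antisymm
    · rintro _ ⟨y, hy, rfl⟩
      refine ⟨?_, ?_⟩
      · rw [← hfm2]; exact hmono hy.1
      · rw [← hf2]; exact hmono hy.2
    · have := intermediate_value_Ioo (by norm_num : (-2 : ℝ) ≤ 2) hfc.continuousOn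
      rwa [hf2, hfm2] at this
  have hB : IntervalIntegrable (fun x : ℝ => (4 - x ^ 2) ^ (l - 3 / 2)) volume (-2) 2 := by
    have := (aux_beta2 (l - 1 / 2) (by linarith)).1
    rwa [show l - 1 / 2 - 1 = l - 3 / 2 by ring] at this
  have hB2 : IntervalIntegrable (fun x : ℝ => (4 - x ^ 2) ^ (l - 3 / 2) * (r * x / 2 / w x))
      volume (-2) 2 := by
    apply hB.mul_continuousOn
    apply Continuous.continuousOn
    exact Continuous.div (by fun_prop) hwc fun y => (hwp y).ne'
  have hodd : ∫ x in (-2 : ℝ)..2, (4 - x ^ 2) ^ (l - 3 / 2) * (r * x / 2 / w x) = 0 := by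
    have h := intervalIntegral.integral_comp_neg (a := -2) (b := 2)
      (fun x : ℝ => (4 - x ^ 2) ^ (l - 3 / 2) * (r * x / 2 / w x))
    have e : ∀ x : ℝ, (4 - (-x) ^ 2) ^ (l - 3 / 2) * (r * (-x) / 2 / w (-x)) =
        - ((4 - x ^ 2) ^ (l - 3 / 2) * (r * x / 2 / w x)) := by
      intro x
      have : w (-x) = w x := by simp only [hw]; congr 1; ring
      rw [this, neg_sq]; ring
    simp only [e, intervalIntegral.integral_neg, neg_neg] at h
    linarith
  rw [intervalIntegral.integral_of_le (by norm_num), integral_Ioc_eq_integral_Ioo]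
  conv_lhs => rw [← himg]
  rw [integral_image_eq_integral_abs_deriv_smul measurableSet_Ioo
    (fun x _ => (hder x).hasDerivWithinAt) hmono.injective.injOn]
  have hpt : ∀ y ∈ Ioo (-2 : ℝ) 2, |(w y - r * y / 2) ^ 2 / w y| •
      ((r + 1 / r - f y) ^ (-l) * (4 - f y ^ 2) ^ (l - 3 / 2)) =
      r ^ l / (1 - r ^ 2) * ((4 - y ^ 2) ^ (l - 3 / 2) +
        (4 - y ^ 2) ^ (l - 3 / 2) * (r * y / 2 / w y)) := by
    intro y hy
    have hd := hwd y
    have hp := hwp y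
    have hs := hws y
    rw [abs_of_pos (hpos y), smul_eq_mul]
    set d := w y - r * y / 2 with hdd
    have a1 : r + 1 / r - f y = d ^ 2 / r := by
      simp only [hf, hdd]
      field_simp
      linear_combination (-16) * hs
    have a2 : 4 - f y ^ 2 = (4 - y ^ 2) * d ^ 2 := by
      simp only [hf, hdd]
      linear_combination (-4) * hs
    have hy4 : 0 < 4 - y ^ 2 := by nlinarith [hy.1, hy.2]
    have a3 : (1 : ℝ) / d = (w y + r * y / 2) / (1 - r ^ 2) := by
      rw [div_eq_div_iff hd.ne' h0.ne', hdd]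
      linear_combination (-1) * hs
    rw [a1, a2, Real.div_rpow (by positivity) hr.le, Real.mul_rpow hy4.le (by positivity),
      Real.rpow_neg hr.le]
    have a4 : (d ^ 2) ^ (-l) * (d ^ 2) ^ (l - 3 / 2) * d ^ 2 = 1 / d := by
      rw [← Real.rpow_add (by positivity), ← Real.rpow_natCast, ← Real.rpow_mul hd.le,
        ← Real.rpow_add hd, one_div, ← Real.rpow_neg_one]
      congr 1; push_cast; ring
    calc _ = r ^ l * (4 - y ^ 2) ^ (l - 3 / 2) / w y *
          ((d ^ 2) ^ (-l) * (d ^ 2) ^ (l - 3 / 2) * d ^ 2) := by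
            field_simp
      _ = _ := by
        rw [a4, a3]; field_simp
  rw [setIntegral_congr_fun measurableSet_Ioo hpt, ← integral_Ioc_eq_integral_Ioo,
    ← intervalIntegral.integral_of_le (by norm_num), intervalIntegral.integral_const_mul,
    intervalIntegral.integral_add hB hB2, hodd, add_zero]

theorem stmt_4 (l : ℝ) (hl : 1 / 2 < l) (z : ℝ) (hz : 2 < z) :
    ∫ x in (-2 : ℝ)..2, (z - x) ^ (-l) * (4 - x ^ 2) ^ (l - 3 / 2) =
      (4 : ℝ) ^ (2 * l - 2) * (Real.Gamma (l - 1 / 2) ^ 2 / Real.Gamma (2 * l - 1)) *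
        ((z - Real.sqrt (z ^ 2 - 4)) / 2) ^ (l - 1) / Real.sqrt (z ^ 2 - 4) := by
  have hq : 0 < z ^ 2 - 4 := by nlinarith
  have hS := Real.sqrt_pos.2 hq
  have hSs := Real.sq_sqrt hq.le
  set S := Real.sqrt (z ^ 2 - 4) with hSdef
  set r := (z - S) / 2 with hrdef
  have hr : 0 < r := by
    have : S < z := by nlinarith
    rw [hrdef]; linarith
  have hr1 : r < 1 := by
    have : z - 2 < S := by nlinarith
    rw [hrdef]; linarith
  have hzr : z = r + 1 / r := by
    field_simp
    rw [hrdef]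
    linear_combination (-1 / 4) * hSs
  have hSr : S = (1 - r ^ 2) / r := by
    have : S = z - 2 * r := by rw [hrdef]; ring
    rw [this, hzr]; field_simp; ring
  have h0 : 0 < 1 - r ^ 2 := by nlinarith
  have hm := aux_main l r hl hr hr1
  rw [← hzr] at hm
  have hb := (aux_beta2 (l - 1 / 2) (by linarith)).2
  rw [show l - 1 / 2 - 1 = l - 3 / 2 by ring, show 2 * (l - 1 / 2) = 2 * l - 1 by ring,
    show 2 * l - 1 - 1 = 2 * l - 2 by ring] at hb
  rw [hm, hb, hSr, Real.rpow_sub_one hr.ne']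
  field_simp
end

section
/- For every real λ ≥ 1 and every natural number n, the normalized even moment m_{2n}^{λ} := c_λ^{-1} ∫_{-2}^{2} x^{2n} cos[(1 - 1/λ) arcsin(x/2)] (4-x²)^{-1/(2λ)} dx satisfies m_{2n}^{λ} = 4ⁿ Σ_{k=0}^{n} (-1)^k C(n,k) · (1 - 1/(2λ))_k (3/2 - 1/(2λ))_k / ((2 - 1/λ)_k · k!), i.e., m_{2n}^{λ} = 4ⁿ · ₃F₂(-n, 1-1/(2λ), 3/2-1/(2λ); 2-1/λ, 1; 1) as a terminating hypergeometric sum. -/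
lemma base_circle (a : ℝ) (ha : 0 < a) :
    ∫ t in (0:ℝ)..(2 * Real.pi), (circleMap 1 1 t) ^ (a : ℂ) = 2 * Real.pi := by
  have h := circleAverage_of_differentiable_on_off_countable (f := fun z : ℂ => z ^ (a:ℂ))
    (c := 1) (R := 1) (s := ∅) Set.countable_empty
    (by
      intro z hz
      apply ContinuousAt.continuousWithinAt
      apply Complex.continuousAt_cpow_const_of_re_pos
      · left
        simp only [abs_one, Metric.mem_closedBall, dist_eq_norm] at hz
        have := (Complex.abs_re_le_norm (z - 1)).trans hz
        rw [abs_le] at this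
        simp at this
        linarith [this.1]
      · simpa using ha)
    (by
      intro z hz
      have hz := hz.1
      simp only [abs_one, Metric.mem_ball, dist_eq_norm] at hz
      have := (Complex.abs_re_le_norm (z - 1)).trans_lt hz
      rw [abs_lt] at this
      simp at this
      exact differentiableAt_id.cpow_const (Or.inl (by simp only [id]; linarith [this.1])))
  rw [Real.circleAverage_def] at h
  simp only [Complex.one_cpow] at h
  have h2 : ((2 * Real.pi)⁻¹ : ℝ) ≠ 0 := by positivity
  have hpi : (Real.pi : ℂ) ≠ 0 := by exact_mod_cast Real.pi_ne_zero
  rw [Complex.real_smul] at h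
  push_cast at h
  field_simp at h
  rw [h]

lemma re_circle (a t : ℝ) (ht : t ∈ Set.Ioo (-Real.pi) Real.pi) :
    ((circleMap 1 1 t) ^ (a : ℂ)).re = Real.cos (a * (t/2)) * (2 * Real.cos (t/2)) ^ a := by
  have hc : 0 < Real.cos (t/2) := Real.cos_pos_of_mem_Ioo ⟨by linarith [ht.1], by linarith [ht.2]⟩
  have e : circleMap 1 1 t = ((2 * Real.cos (t/2) : ℝ) : ℂ) * Complex.exp ((t/2 : ℝ) * Complex.I) := by
    simp only [circleMap]
    have : (t : ℂ) * Complex.I = ((t/2 : ℝ) * Complex.I) + ((t/2 : ℝ) * Complex.I) := by push_cast; ring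
    rw [this, Complex.exp_add]
    push_cast
    rw [Complex.cos, mul_div_cancel₀ _ two_ne_zero, add_mul, ← Complex.exp_add, neg_mul, ← Complex.exp_add]
    simp
    ring
  have hne : circleMap 1 1 t ≠ 0 := by
    rw [e]; apply mul_ne_zero
    · exact_mod_cast (by positivity)
    · exact Complex.exp_ne_zero _
  rw [Complex.cpow_def_of_ne_zero hne, e, Complex.log_ofReal_mul (by positivity) (Complex.exp_ne_zero _),
    Complex.log_exp (by simp; linarith [ht.1, Real.pi_pos]) (by simp; linarith [ht.2, Real.pi_pos]),
    Complex.exp_re, Real.rpow_def_of_pos (by positivity)]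
  have : (((Real.log (2 * Real.cos (t/2)) : ℝ) : ℂ) + ((t/2 : ℝ) : ℂ) * Complex.I) * (a : ℂ)
    = ((Real.log (2 * Real.cos (t/2)) * a : ℝ) : ℂ) + ((a * (t/2) : ℝ) : ℂ) * Complex.I := by push_cast; ring
  rw [this]
  simp [-Complex.ofReal_mul, -Complex.ofReal_div]
  ring

lemma base (a : ℝ) (ha : 0 ≤ a) :
    ∫ t in (-(Real.pi/2))..(Real.pi/2), Real.cos (a * t) * (2 * Real.cos t) ^ a = Real.pi := by
  rcases ha.eq_or_lt with rfl | ha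
  · simp
  have h := base_circle a ha
  have hp : Function.Periodic (fun t => (circleMap 1 1 t) ^ (a : ℂ)) (2 * Real.pi) := by
    intro t; simp only [periodic_circleMap 1 1 t]
  have h2 := hp.intervalIntegral_add_eq 0 (-Real.pi)
  have ci : Continuous (fun t => (circleMap 1 1 t) ^ (a : ℂ)) := by
    rw [continuous_iff_continuousAt]
    intro t
    apply ContinuousAt.comp (g := fun z : ℂ => z ^ (a:ℂ)) _ (continuous_circleMap 1 1).continuousAt
    apply Complex.continuousAt_cpow_const_of_re_pos
    · left
      simp [circleMap, Complex.exp_re]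
      linarith [Real.neg_one_le_cos t]
    · simpa using ha
  rw [zero_add, h, show -Real.pi + 2 * Real.pi = Real.pi by ring] at h2
  have h3 := Complex.reCLM.intervalIntegral_comp_comm (ci.intervalIntegrable (μ := MeasureTheory.volume) (-Real.pi) Real.pi)
  rw [← h2] at h3
  simp only [Complex.reCLM_apply] at h3
  have h4 : ∫ t in (-Real.pi)..Real.pi, ((circleMap 1 1 t) ^ (a : ℂ)).re =
      ∫ t in (-Real.pi)..Real.pi, (fun s => Real.cos (a * s) * (2 * Real.cos s) ^ a) (t/2) := by
    rw [intervalIntegral.integral_of_le (by linarith [Real.pi_pos]),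
      intervalIntegral.integral_of_le (by linarith [Real.pi_pos]),
      MeasureTheory.integral_Ioc_eq_integral_Ioo, MeasureTheory.integral_Ioc_eq_integral_Ioo]
    exact MeasureTheory.setIntegral_congr_fun measurableSet_Ioo (fun t ht => re_circle a t ht)
  rw [h4, intervalIntegral.integral_comp_div (fun s => Real.cos (a * s) * (2 * Real.cos s) ^ a) two_ne_zero] at h3
  simp at h3
  rw [← neg_div]
  exact h3

lemma step (a p : ℝ) (hp : 0 ≤ p) :
    ((p+2)^2 - a^2) * ∫ t in (-(Real.pi/2))..(Real.pi/2), Real.cos (a * t) * (Real.cos t) ^ (p+2) =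
    (p+2)*(p+1) * ∫ t in (-(Real.pi/2))..(Real.pi/2), Real.cos (a * t) * (Real.cos t) ^ p := by
  have cc : ∀ q : ℝ, 0 ≤ q → Continuous fun t : ℝ => Real.cos t ^ q :=
    fun q hq => Real.continuous_cos.rpow_const (fun _ => Or.inr hq)
  have c0 := cc p hp
  have c1 := cc (p+1) (by linarith)
  have c2 := cc (p+2) (by linarith)
  have i1 : Continuous fun t : ℝ => Real.cos (a * t) * (Real.cos t) ^ (p+2) := by fun_prop
  have i0 : Continuous fun t : ℝ => Real.cos (a * t) * (Real.cos t) ^ p := by fun_prop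
  have key := intervalIntegral.integral_eq_sub_of_hasDerivAt_of_le
    (a := -(Real.pi/2)) (b := Real.pi/2)
    (f := fun t => (p+2) * (Real.cos t ^ (p+1) * Real.sin t * Real.cos (a*t)) - a * (Real.cos t ^ (p+2) * Real.sin (a*t)))
    (f' := fun t => ((p+2)^2 - a^2) * (Real.cos (a * t) * (Real.cos t) ^ (p+2)) -
      (p+2)*(p+1) * (Real.cos (a * t) * (Real.cos t) ^ p))
    (by linarith [Real.pi_pos])
    (by apply Continuous.continuousOn; fun_prop)
    (by
      intro t ht
      have hc : 0 < Real.cos t := Real.cos_pos_of_mem_Ioo ht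
      have d1 := (Real.hasDerivAt_cos t).rpow_const (p := p+1) (Or.inl hc.ne')
      have d2 := (Real.hasDerivAt_cos t).rpow_const (p := p+2) (Or.inl hc.ne')
      have hat : HasDerivAt (fun t : ℝ => a * t) a t := by simpa using (hasDerivAt_id t).const_mul a
      have ds := (Real.hasDerivAt_sin t)
      have d := (((d1.mul ds).mul hat.cos).const_mul (p+2)).sub ((d2.mul hat.sin).const_mul a)
      refine HasDerivAt.congr_deriv (f := fun t => (p+2) * (Real.cos t ^ (p+1) * Real.sin t * Real.cos (a*t)) - a * (Real.cos t ^ (p+2) * Real.sin (a*t))) d ?_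
      symm
      rw [show p + 1 - 1 = p by ring, show p + 2 - 1 = p + 1 by ring,
        show Real.cos t ^ (p+2) = Real.cos t ^ p * Real.cos t ^ 2 by
          rw [Real.rpow_add hc]; norm_num, Real.rpow_add hc p 1, Real.rpow_one]
      simp only [Pi.mul_apply]
      rw [Real.rpow_add hc p 1, Real.rpow_one]
      have := Real.sin_sq_add_cos_sq t
      have hs : Real.sin t ^ 2 = 1 - Real.cos t ^ 2 := by linarith
      ring_nf
      rw [hs]
      ring)
    (by apply Continuous.intervalIntegrable; fun_prop)
  rw [intervalIntegral.integral_sub ((i1.const_mul _).intervalIntegrable _ _) ((i0.const_mul _).intervalIntegrable _ _),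
    intervalIntegral.integral_const_mul, intervalIntegral.integral_const_mul] at key
  simp [Real.zero_rpow (show p+1 ≠ 0 by linarith), Real.zero_rpow (show p+2 ≠ 0 by linarith)] at key
  linarith

lemma closed (a : ℝ) (ha : 0 ≤ a) (k : ℕ) :
    2 ^ a * ∫ t in (-(Real.pi/2))..(Real.pi/2), Real.cos (a * t) * (Real.cos t) ^ (a + 2 * k) =
    Real.pi * ((ascPochhammer ℝ k).eval ((1+a)/2) * (ascPochhammer ℝ k).eval (1 + a/2) /
          ((ascPochhammer ℝ k).eval (1+a) * (Nat.factorial k))) := by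
  induction k with
  | zero =>
    simp
    rw [← intervalIntegral.integral_const_mul]
    refine Eq.trans ?_ (base a ha)
    apply intervalIntegral.integral_congr
    intro t ht
    rw [Set.uIcc_of_le (by linarith [Real.pi_pos])] at ht
    have := Real.cos_nonneg_of_mem_Icc ht
    simp only
    rw [Real.mul_rpow (by norm_num) this]; ring
  | succ k ih =>
    have s := step a (a + 2 * k) (by positivity)
    have e : a + 2 * ((k+1 : ℕ) : ℝ) = a + 2 * k + 2 := by push_cast; ring
    rw [e]
    have hne : ((a + 2 * k +2)^2 - a^2) ≠ 0 := by
      have : 0 < ((a + 2 * k +2)^2 - a^2) := by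
        rw [sq_sub_sq]; apply mul_pos <;> ring_nf <;> positivity
      exact this.ne'
    have h1 : (ascPochhammer ℝ k).eval (1+a) ≠ 0 := (ascPochhammer_pos k _ (by positivity)).ne'
    have h2 : (1 + a + k) ≠ 0 := by positivity
    have h3 : (k : ℝ) + 1 ≠ 0 := by positivity
    have h4 : (Nat.factorial k : ℝ) ≠ 0 := by positivity
    rw [eq_div_of_mul_eq hne ((mul_comm _ _).trans s)]
    rw [show ∀ x y z w : ℝ, x * (y * z / w) = (y / w) * (x * z) by intros; ring, ih]
    simp only [ascPochhammer_succ_eval, Nat.factorial_succ]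
    push_cast
    rw [show ((a + 2 * k +2)^2 - a^2) = 4 * (1 + a + k) * (k+1) by ring]
    field_simp
    ring

lemma subst_int (a : ℝ) (n : ℕ) :
    ∫ x in (-2 : ℝ)..2, x ^ (2 * n) * Real.cos (a * Real.arcsin (x / 2)) *
        (4 - x ^ 2) ^ ((a-1)/2) =
    ∫ t in (-(Real.pi/2))..(Real.pi/2), (2:ℝ)^a * (4 * (1 - Real.cos t ^ 2)) ^ n * (Real.cos (a * t) * Real.cos t ^ a) := by
  have hpi := Real.pi_pos
  have him : (fun t => 2 * Real.sin t) '' Set.Ioo (-(Real.pi/2)) (Real.pi/2) = Set.Ioo (-2) 2 := by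
    ext x
    constructor
    · rintro ⟨t, ht, rfl⟩
      have h1 := Real.sin_lt_sin_of_lt_of_le_pi_div_two le_rfl ht.2.le ht.1
      have h2 := Real.sin_lt_sin_of_lt_of_le_pi_div_two ht.1.le le_rfl ht.2
      simp at h1 h2
      constructor <;> simp only <;> linarith
    · intro hx
      refine ⟨Real.arcsin (x/2), ⟨?_, ?_⟩, ?_⟩
      · rw [Real.neg_pi_div_two_lt_arcsin]; linarith [hx.1]
      · rw [Real.arcsin_lt_pi_div_two]; linarith [hx.2]
      · simp only
        rw [Real.sin_arcsin (by linarith [hx.1]) (by linarith [hx.2])]; ring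
  rw [intervalIntegral.integral_of_le (by norm_num), intervalIntegral.integral_of_le (by linarith),
    MeasureTheory.integral_Ioc_eq_integral_Ioo, MeasureTheory.integral_Ioc_eq_integral_Ioo, ← him,
    MeasureTheory.integral_image_eq_integral_abs_deriv_smul (f' := fun t => 2 * Real.cos t) measurableSet_Ioo
      (fun t _ => ((Real.hasDerivAt_sin t).const_mul 2).hasDerivWithinAt)]
  · apply MeasureTheory.setIntegral_congr_fun measurableSet_Ioo
    intro t ht
    have hc : 0 < Real.cos t := Real.cos_pos_of_mem_Ioo ht
    simp only [smul_eq_mul]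
    rw [abs_of_pos (by positivity), mul_div_cancel_left₀ _ two_ne_zero, Real.arcsin_sin ht.1.le ht.2.le]
    have hs : (2 * Real.sin t)^2 = 4 * (1 - Real.cos t ^ 2) := by
      have := Real.sin_sq_add_cos_sq t
      linarith
    rw [pow_mul, hs, show 4 - 4 * (1 - Real.cos t ^2) = (2 * Real.cos t) ^ (2:ℝ) by norm_num; ring,
      ← Real.rpow_mul (by positivity), show 2 * ((a-1)/2) = a - 1 by ring,
      Real.rpow_sub_one (by positivity), Real.mul_rpow (by norm_num) hc.le]
    field_simp
  · intro x hx y hy h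
    apply Real.injOn_sin (Set.Ioo_subset_Icc_self hx) (Set.Ioo_subset_Icc_self hy)
    simpa using h

lemma total (a : ℝ) (ha : 0 ≤ a) (n : ℕ) :
    ∫ x in (-2 : ℝ)..2, x ^ (2 * n) * Real.cos (a * Real.arcsin (x / 2)) *
        (4 - x ^ 2) ^ ((a-1)/2) =
    Real.pi * ((4 : ℝ) ^ n * ∑ k ∈ Finset.range (n + 1), (-1 : ℝ) ^ k * (n.choose k : ℝ) *
      ((ascPochhammer ℝ k).eval ((1+a)/2) * (ascPochhammer ℝ k).eval (1 + a/2) /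
          ((ascPochhammer ℝ k).eval (1+a) * (Nat.factorial k)))) := by
  have cc : ∀ q : ℝ, 0 ≤ q → Continuous fun t : ℝ => Real.cos t ^ q :=
    fun q hq => Real.continuous_cos.rpow_const (fun _ => Or.inr hq)
  rw [subst_int]
  have : ∫ t in (-(Real.pi/2))..(Real.pi/2), (2:ℝ)^a * (4 * (1 - Real.cos t ^ 2)) ^ n * (Real.cos (a * t) * Real.cos t ^ a)
    = ∫ t in (-(Real.pi/2))..(Real.pi/2), ∑ k ∈ Finset.range (n + 1), (4^n * ((-1 : ℝ) ^ k * (n.choose k : ℝ)) * 2^a) *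
      (Real.cos (a * t) * Real.cos t ^ (a + 2 * k)) := by
    apply intervalIntegral.integral_congr
    intro t ht
    rw [Set.uIcc_of_le (by linarith [Real.pi_pos])] at ht
    have hc := Real.cos_nonneg_of_mem_Icc ht
    simp only
    rw [mul_pow, show 1 - Real.cos t ^ 2 = -Real.cos t ^ 2 + 1 by ring, add_pow, Finset.mul_sum, Finset.mul_sum, Finset.sum_mul]
    apply Finset.sum_congr rfl
    intro k _
    rw [Real.rpow_add_of_nonneg hc ha (by positivity), show (2 * (k:ℝ)) = ((2 * k : ℕ) : ℝ) by push_cast; ring,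
      Real.rpow_natCast, neg_pow (Real.cos t ^ 2), ← pow_mul]
    ring
  rw [this, intervalIntegral.integral_finsetSum]
  · rw [Finset.mul_sum, Finset.mul_sum]
    apply Finset.sum_congr rfl
    intro k _
    rw [intervalIntegral.integral_const_mul, mul_assoc, closed a ha k]
    ring
  · intro k _
    have := cc (a + 2 * k) (by positivity)
    apply Continuous.intervalIntegrable
    fun_prop

theorem stmt_10 (l : ℝ) (hl : 1 ≤ l) (n : ℕ) :
    ((2 : ℝ) ^ (1 - 1 / l) * Real.sqrt Real.pi * Real.Gamma (1 - 1 / (2 * l)) *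
          Real.Gamma (3 / 2 - 1 / (2 * l)) / Real.Gamma (2 - 1 / l))⁻¹ *
      ∫ x in (-2 : ℝ)..2, x ^ (2 * n) * Real.cos ((1 - 1 / l) * Real.arcsin (x / 2)) *
        (4 - x ^ 2) ^ (-(1 / (2 * l))) =
      (4 : ℝ) ^ n * ∑ k ∈ Finset.range (n + 1), (-1 : ℝ) ^ k * (n.choose k : ℝ) *
        ((ascPochhammer ℝ k).eval (1 - 1 / (2 * l)) *
            (ascPochhammer ℝ k).eval (3 / 2 - 1 / (2 * l)) /
          ((ascPochhammer ℝ k).eval (2 - 1 / l) * (Nat.factorial k))) := by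
  have hl0 : 0 < l := by linarith
  have ha : 0 ≤ 1 - 1 / l := by
    have : 1 / l ≤ 1 := by rw [div_le_one hl0]; exact hl
    linarith
  have h := total (1 - 1 / l) ha n
  have e1 : (1 - 1 / l - 1) / 2 = -(1 / (2 * l)) := by field_simp; ring
  have e2 : (1 + (1 - 1 / l)) / 2 = 1 - 1 / (2 * l) := by field_simp; ring
  have e3 : 1 + (1 - 1 / l) / 2 = 3 / 2 - 1 / (2 * l) := by field_simp; ring
  have e4 : 1 + (1 - 1 / l) = 2 - 1 / l := by ring
  rw [e1, e2, e3, e4] at h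
  rw [h]
  have hG : (2 : ℝ) ^ (1 - 1 / l) * Real.sqrt Real.pi * Real.Gamma (1 - 1 / (2 * l)) *
          Real.Gamma (3 / 2 - 1 / (2 * l)) / Real.Gamma (2 - 1 / l) = Real.pi := by
    have d := Real.Gamma_mul_Gamma_add_half (1 - 1 / (2 * l))
    rw [show 1 - 1 / (2 * l) + 1 / 2 = 3 / 2 - 1 / (2 * l) by ring,
      show 2 * (1 - 1 / (2 * l)) = 2 - 1 / l by field_simp] at d
    have hg : Real.Gamma (2 - 1 / l) ≠ 0 := (Real.Gamma_pos_of_pos (by linarith)).ne'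
    rw [mul_assoc _ (Real.Gamma _) (Real.Gamma _), d, show 1 - (2 - 1 / l) = -(1 - 1 / l) by ring,
      Real.rpow_neg (by norm_num)]
    have h2 : (2 : ℝ) ^ (1 - 1 / l) ≠ 0 := by positivity
    have hs := Real.mul_self_sqrt Real.pi_pos.le
    generalize (2 : ℝ) ^ (1 - 1 / l) = u at *
    generalize Real.Gamma (2 - 1 / l) = v at *
    rw [div_eq_iff hg]
    calc u * √Real.pi * (v * u⁻¹ * √Real.pi) = (u * u⁻¹) * v * (√Real.pi * √Real.pi) := by ring
      _ = Real.pi * v := by rw [hs, mul_inv_cancel₀ h2]; ring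
  rw [hG, inv_mul_cancel_left₀ Real.pi_ne_zero]
end

section
/- For every real λ ≥ 1 and every natural number n, ∫_{-2}^{2} x^{2n} cos[(1 - 1/λ) arcsin(x/2)] (4-x²)^{-1/(2λ)} dx = 4ⁿ π Σ_{k=0}^{n} C(n,k) (-1/4)^k · Γ(2k + 2 - 1/λ) / (Γ(k + 2 - 1/λ) · k!). -/
open Real intervalIntegral in
lemma aux_base_pos (b : ℝ) (hb : 0 < b) :
    ∫ t in (-(π/2))..(π/2), (2 * cos t) ^ b * cos (b * t) = π := by
  set f : ℂ → ℂ := fun z => (1 + z) ^ (b : ℂ) with hf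
  have hd : DiffContOnCl ℂ f (Metric.ball 0 |(1:ℝ)|) := by
    constructor
    · intro z hz
      have hz' : ‖z‖ < 1 := by simpa using hz
      have h1 : (1 + z) ∈ Complex.slitPlane := by
        left
        have := (abs_le.1 (Complex.abs_re_le_norm z)).1
        simp; linarith
      exact ((differentiableAt_id.const_add (1:ℂ)).cpow_const h1).differentiableWithinAt
    · intro z hz
      have hz' : ‖z‖ ≤ 1 := by
        have := Metric.closure_ball_subset_closedBall hz
        simpa using this
      have h1 : 0 ≤ (1 + z).re := by
        have := (abs_le.1 (Complex.abs_re_le_norm z)).1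
        simp; linarith
      have h2 := Complex.continuousAt_cpow_const_of_re_pos (z := 1 + z) (w := (b:ℂ)) (Or.inl h1)
        (by simpa using hb)
      have h3 : ContinuousAt f z := by
        have h4 : ContinuousAt (fun z : ℂ => 1 + z) z := by fun_prop
        exact ContinuousAt.comp (f := fun z : ℂ => 1 + z) (g := fun x : ℂ => x ^ (b:ℂ)) h2 h4
      exact h3.continuousWithinAt
  have hA := hd.circleAverage
  rw [circleAverage_def] at hA
  have hf0 : f 0 = 1 := by simp [hf]
  rw [hf0] at hA
  have hper : Function.Periodic (fun t : ℝ => f (circleMap 0 1 t)) (2 * π) := by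
    intro t; simp only [periodic_circleMap 0 1 t]
  have h5 := hper.intervalIntegral_add_eq 0 (-π)
  rw [zero_add, show -π + 2 * π = π by ring] at h5
  rw [h5] at hA
  have h6 : ∫ t in (-π)..π, f (circleMap 0 1 t)
      = (2:ℝ) • ∫ t in (-(π/2))..(π/2), f (circleMap 0 1 (2 * t)) := by
    rw [intervalIntegral.smul_integral_comp_mul_left (fun t => f (circleMap 0 1 t))]
    congr 1 <;> ring
  set g : ℝ → ℂ := fun t => (((2 * cos t) ^ b : ℝ) : ℂ) * Complex.exp ((b * t : ℝ) * Complex.I) with hg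
  have hgc : Continuous g := by
    have : Continuous (fun t : ℝ => (2 * cos t) ^ b) :=
      Continuous.rpow_const (by fun_prop) (fun _ => Or.inr hb.le)
    rw [hg]; fun_prop
  have h7 : ∫ t in (-(π/2))..(π/2), f (circleMap 0 1 (2 * t)) = ∫ t in (-(π/2))..(π/2), g t := by
    apply integral_congr_uIoo
    intro t ht
    rw [Set.uIoo_of_le (by linarith [pi_pos])] at ht
    have hc : 0 < 2 * cos t := by have := cos_pos_of_mem_Ioo ht; linarith
    have e1 : (1 + circleMap 0 1 (2 * t) : ℂ) = ((2 * cos t : ℝ) : ℂ) * Complex.exp (t * Complex.I) := by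
      have : ((2 * cos t : ℝ) : ℂ) = Complex.exp (t * Complex.I) + Complex.exp (-(t * Complex.I)) := by
        push_cast; rw [Complex.two_cos]; ring_nf
      rw [this, add_mul, ← Complex.exp_add, ← Complex.exp_add, circleMap]
      simp; ring_nf
    simp only [hf, hg]
    have hne : (((2 * cos t : ℝ) : ℂ) * Complex.exp (t * Complex.I)) ≠ 0 :=
      mul_ne_zero (by exact_mod_cast hc.ne') (Complex.exp_ne_zero _)
    rw [e1, Complex.cpow_def_of_ne_zero hne, Complex.log_ofReal_mul hc (Complex.exp_ne_zero _),
      Complex.log_exp (by simp; linarith [ht.1, pi_pos]) (by simp; linarith [ht.2, pi_pos]),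
      add_mul, Complex.exp_add, rpow_def_of_pos hc]
    push_cast
    ring_nf
  have h8 := Complex.reCLM.intervalIntegral_comp_comm (hgc.intervalIntegrable (μ := MeasureTheory.volume) (-(π/2)) (π/2))
  have h9 : ∀ t, Complex.reCLM (g t) = (2 * cos t) ^ b * cos (b * t) := by
    intro t
    simp only [hg, Complex.reCLM_apply, Complex.re_ofReal_mul, Complex.exp_ofReal_mul_I_re]
  simp only [h9] at h8
  rw [h8, ← h7]
  rw [h6] at hA
  have h10 : ∫ t in (-(π/2))..(π/2), f (circleMap 0 1 (2 * t)) = (π : ℂ) := by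
    rw [smul_smul] at hA
    have hp : (π:ℂ) ≠ 0 := by exact_mod_cast pi_ne_zero
    have h2 : ((2 * π)⁻¹ * 2 : ℝ) = π⁻¹ := by field_simp
    rw [h2, Complex.real_smul] at hA
    push_cast at hA
    field_simp at hA
    exact hA
  rw [h10]; simp

open Real intervalIntegral in
lemma aux_base (b : ℝ) (hb : 0 ≤ b) :
    ∫ t in (-(π/2))..(π/2), (2 * cos t) ^ b * cos (b * t) = π := by
  rcases hb.eq_or_lt with rfl | h
  · simp
  · exact aux_base_pos b h

open Real intervalIntegral in
lemma aux_cont (b p : ℝ) (hp : 0 ≤ p) : Continuous (fun t : ℝ => (2 * cos t) ^ p * cos (b * t)) := by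
  have : Continuous (fun t : ℝ => (2 * cos t) ^ p) :=
      Continuous.rpow_const (by fun_prop) (fun _ => Or.inr hp)
  fun_prop

open Real intervalIntegral in
lemma aux_rec (b p : ℝ) (hp : 0 ≤ p) :
    ((p+2)^2 - b^2) * ∫ t in (-(π/2))..(π/2), (2 * cos t) ^ (p+2) * cos (b * t)
      = 4 * ((p+2) * (p+1)) * ∫ t in (-(π/2))..(π/2), (2 * cos t) ^ p * cos (b * t) := by
  have hI := fun q hq => (aux_cont b q hq).intervalIntegrable (μ := MeasureTheory.volume) (-(π/2)) (π/2)
  have c1 : Continuous (fun t : ℝ => (2 * cos t) ^ (p+1)) :=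
      Continuous.rpow_const (by fun_prop) (fun _ => Or.inr (by linarith))
  have c2 : Continuous (fun t : ℝ => (2 * cos t) ^ (p+2)) :=
      Continuous.rpow_const (by fun_prop) (fun _ => Or.inr (by linarith))
  have key := integral_eq_sub_of_hasDerivAt_of_le (a := -(π/2)) (b := π/2)
    (f := fun t => (p+2) * ((2 * cos t) ^ (p+1) * (2 * sin t) * cos (b * t))
      - b * ((2 * cos t)^(p+2) * sin (b * t)))
    (f' := fun t => ((p+2)^2 - b^2) * ((2 * cos t) ^ (p+2) * cos (b * t))
      - 4 * ((p+2) * (p+1)) * ((2 * cos t) ^ p * cos (b * t)))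
    (by linarith [pi_pos]) (Continuous.continuousOn (by fun_prop))
    (by
      intro t ht
      have hc : 0 < 2 * cos t := by have := cos_pos_of_mem_Ioo ht; linarith
      have d0 : HasDerivAt (fun t => 2 * cos t) (2 * (-sin t)) t := (hasDerivAt_cos t).const_mul 2
      have d1 := d0.rpow_const (p := p+1) (Or.inl hc.ne')
      have d2 := d0.rpow_const (p := p+2) (Or.inl hc.ne')
      have db : HasDerivAt (fun t : ℝ => b * t) b t := by simpa using (hasDerivAt_id t).const_mul b
      have d3 := ((d1.mul ((hasDerivAt_sin t).const_mul 2)).mul db.cos).const_mul (p+2)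
      have d4 := (d2.mul db.sin).const_mul b
      have d5 := d3.sub d4
      refine d5.congr_deriv ?_
      have r1 : (2 * cos t) ^ (p+1) = (2 * cos t) ^ p * (2 * cos t) := by
        rw [rpow_add hc, rpow_one]
      have r2 : (2 * cos t) ^ (p+2) = (2 * cos t) ^ p * (2 * cos t)^2 := by
        rw [rpow_add hc]; norm_num
      have r3 : p + 1 - 1 = p := by ring
      have r4 : p + 2 - 1 = p + 1 := by ring
      simp only [r3, r4, Pi.mul_apply]
      rw [r1, r2]
      have hs : sin t ^ 2 = 1 - cos t ^ 2 := by rw [← sin_sq_add_cos_sq t]; ring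
      ring_nf
      rw [hs]
      ring)
    (((hI _ (by linarith)).const_mul _).sub ((hI _ hp).const_mul _))
  rw [integral_sub ((hI _ (by linarith)).const_mul _) ((hI _ hp).const_mul _),
    integral_const_mul, integral_const_mul] at key
  have z1 : (0:ℝ)^(p+1) = 0 := zero_rpow (by linarith)
  have z2 : (0:ℝ)^(p+2) = 0 := zero_rpow (by linarith)
  simp only [cos_neg, cos_pi_div_two, mul_zero, z1, z2, zero_mul, sub_zero] at key
  linarith

open Real intervalIntegral in
lemma aux_I (b : ℝ) (hb : 0 ≤ b) (k : ℕ) :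
    ∫ t in (-(π/2))..(π/2), (2 * cos t) ^ (2 * (k:ℝ) + b) * cos (b * t)
      = π * (Gamma (2 * (k:ℝ) + b + 1) / (Gamma ((k:ℝ) + b + 1) * (Nat.factorial k))) := by
  induction k with
  | zero =>
    have := (Gamma_pos_of_pos (show 0 < b + 1 by linarith)).ne'
    simp [aux_base b hb, this]
  | succ k ih =>
    have h := aux_rec b (2 * (k:ℝ) + b) (by positivity)
    rw [ih] at h
    have e : 2 * ((k+1 : ℕ):ℝ) + b = 2 * (k:ℝ) + b + 2 := by push_cast; ring
    rw [e]
    have g1 : Gamma (2 * (k:ℝ) + b + 2 + 1) = (2 * (k:ℝ) + b + 2) * ((2 * (k:ℝ) + b + 1) * Gamma (2 * (k:ℝ) + b + 1)) := by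
      rw [Gamma_add_one (by positivity), show 2 * (k:ℝ) + b + 2 = (2 * (k:ℝ) + b + 1) + 1 by ring,
        Gamma_add_one (by positivity)]
    have g2 : Gamma (((k+1:ℕ):ℝ) + b + 1) = ((k:ℝ) + b + 1) * Gamma ((k:ℝ) + b + 1) := by
      rw [← Gamma_add_one (by positivity)]; push_cast; ring_nf
    rw [g1, g2, Nat.factorial_succ]
    have p1 : 0 < Gamma ((k:ℝ) + b + 1) := Gamma_pos_of_pos (by positivity)
    have p2 : (0:ℝ) < (k:ℝ) + b + 1 := by positivity
    have p3 : (0:ℝ) < (k:ℝ) + 1 := by positivity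
    have p4 : (0:ℝ) < (Nat.factorial k : ℝ) := by positivity
    have e2 : (2 * (k:ℝ) + b + 2)^2 - b^2 = 4 * (((k:ℝ)+1) * ((k:ℝ) + b + 1)) := by ring
    rw [e2] at h
    have hne : 4 * (((k:ℝ)+1) * ((k:ℝ) + b + 1)) ≠ 0 := by positivity
    apply mul_left_cancel₀ hne
    rw [h]
    push_cast
    field_simp

open Real intervalIntegral in
theorem stmt_11 (l : ℝ) (hl : 1 ≤ l) (n : ℕ) :
    ∫ x in (-2 : ℝ)..2, x ^ (2 * n) * Real.cos ((1 - 1 / l) * Real.arcsin (x / 2)) *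
        (4 - x ^ 2) ^ (-(1 / (2 * l))) =
      (4 : ℝ) ^ n * Real.pi * ∑ k ∈ Finset.range (n + 1), (n.choose k : ℝ) *
        (-1 / 4 : ℝ) ^ k *
        (Real.Gamma (2 * (k : ℝ) + 2 - 1 / l) /
          (Real.Gamma ((k : ℝ) + 2 - 1 / l) * (Nat.factorial k))) := by
  have hl0 : 0 < l := by linarith
  obtain ⟨b, hb⟩ : ∃ b, b = 1 - 1 / l := ⟨_, rfl⟩
  have hb0 : 0 ≤ b := by
    have : 1 / l ≤ 1 := by rw [div_le_one hl0]; exact hl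
    linarith
  have hpow : -(1 / (2 * l)) = (b - 1) / 2 := by rw [hb]; field_simp; ring
  have hlb : 1 / l = 1 - b := by rw [hb]; ring
  rw [← hb, hpow, hlb]
  have himg : (fun t => 2 * sin t) '' (Set.Ioo (-(π/2)) (π/2)) = Set.Ioo (-2) 2 := by
    ext x
    constructor
    · rintro ⟨t, ht, rfl⟩
      have hc := cos_pos_of_mem_Ioo ht
      have := sin_sq_add_cos_sq t
      constructor <;> simp only <;> nlinarith
    · rintro ⟨h1, h2⟩
      refine ⟨arcsin (x/2), ⟨?_, ?_⟩, ?_⟩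
      · rw [neg_pi_div_two_lt_arcsin]; linarith
      · rw [arcsin_lt_pi_div_two]; linarith
      · simp only
        rw [sin_arcsin (by linarith) (by linarith)]; ring
  have hinj : Set.InjOn (fun t => 2 * sin t) (Set.Ioo (-(π/2)) (π/2)) := by
    intro s hs t ht h
    exact injOn_sin (Set.Ioo_subset_Icc_self hs) (Set.Ioo_subset_Icc_self ht) (by simpa using h)
  rw [integral_of_le (by norm_num), MeasureTheory.integral_Ioc_eq_integral_Ioo, ← himg,
    MeasureTheory.integral_image_eq_integral_abs_deriv_smul measurableSet_Ioo
      (f' := fun t => 2 * cos t)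
      (fun t _ => ((hasDerivAt_sin t).const_mul 2).hasDerivWithinAt) hinj]
  have hcongr : ∀ t ∈ Set.Ioo (-(π/2)) (π/2),
      |2 * cos t| • ((2 * sin t) ^ (2 * n) * cos (b * arcsin (2 * sin t / 2)) *
        (4 - (2 * sin t) ^ 2) ^ ((b - 1) / 2))
      = ∑ k ∈ Finset.range (n + 1), (4:ℝ)^n * ((n.choose k : ℝ) * (-1/4:ℝ)^k) *
          ((2 * cos t) ^ (2 * (k:ℝ) + b) * cos (b * t)) := by
    intro t ht
    have hc : 0 < 2 * cos t := by have := cos_pos_of_mem_Ioo ht; linarith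
    have a1 : arcsin (2 * sin t / 2) = t := by
      rw [mul_div_cancel_left₀ _ two_ne_zero, arcsin_sin ht.1.le ht.2.le]
    have a2 : 4 - (2 * sin t)^2 = (2 * cos t)^(2:ℝ) := by
      rw [rpow_two]; nlinarith [sin_sq_add_cos_sq t]
    have a3 : (2 * cos t) * (2 * cos t) ^ (b - 1) = (2 * cos t) ^ b := by
      rw [rpow_sub_one hc.ne', mul_div_cancel₀ _ hc.ne']
    have a4 : (2 * sin t)^(2*n) = 4^n * ∑ k ∈ Finset.range (n + 1), (n.choose k : ℝ) * (-1/4:ℝ)^k * (2 * cos t)^(2*k) := by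
      have : (2 * sin t)^(2*n) = 4^n * (-1/4 * (2 * cos t)^2 + 1)^n := by
        rw [pow_mul, ← mul_pow]; congr 1; linear_combination 4 * sin_sq_add_cos_sq t
      rw [this, add_pow]
      congr 1
      apply Finset.sum_congr rfl
      intro k _
      rw [mul_pow, ← pow_mul]; ring
    rw [a1, a2, ← rpow_mul hc.le, mul_div_cancel₀ _ two_ne_zero, abs_of_pos hc, smul_eq_mul,
      show ∀ A B C D : ℝ, A * (B * C * D) = B * C * (A * D) by intros; ring, a3, a4,
      Finset.mul_sum, Finset.sum_mul, Finset.sum_mul]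
    apply Finset.sum_congr rfl
    intro k _
    have : (2 * cos t) ^ (2 * (k:ℝ) + b) = (2 * cos t)^(2*k) * (2 * cos t)^b := by
      rw [rpow_add hc, ← rpow_natCast]; push_cast; rfl
    rw [this]; ring
  rw [MeasureTheory.setIntegral_congr_fun measurableSet_Ioo hcongr,
    ← MeasureTheory.integral_Ioc_eq_integral_Ioo, ← integral_of_le (by linarith [pi_pos]),
    integral_finsetSum]
  · rw [Finset.mul_sum]
    apply Finset.sum_congr rfl
    intro k _
    rw [integral_const_mul, aux_I b hb0 k,
      show 2 * (k:ℝ) + 2 - (1 - b) = 2 * (k:ℝ) + b + 1 by ring,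
      show (k:ℝ) + 2 - (1 - b) = (k:ℝ) + b + 1 by ring]
    ring
  · intro k _
    exact ((aux_cont b _ (by positivity)).intervalIntegrable _ _).const_mul _
end

section
/- For every real λ > 1/2 there exists a constant c > 0, namely c = ∫_{-2}^{2} sin[(1 - 1/(2λ))(arcsin(x/2) + π/2)] (2-x)^{-1/(2λ)} dx, such that for every real z > 2, ∫_{-2}^{2} (z-x)^{-1} sin[(1 - 1/(2λ))(arcsin(x/2) + π/2)] (2-x)^{-1/(2λ)} dx = c · G(z)^{1-1/(2λ)} · (z-2)^{-1/(2λ)}, where G(z) = (z - √(z²-4))/2. -/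
namespace S16
open Complex MeasureTheory Set Filter Topology

noncomputable def g (q s : ℝ) (v : ℂ) : ℂ := ((s : ℂ) - v) ^ (q : ℂ) * (1 + v)

lemma slit {s : ℝ} (hs : 1 < s) {v : ℂ} (hv : ‖v‖ ≤ 1) : (s : ℂ) - v ∈ slitPlane := by
  left
  have := (Complex.abs_re_le_norm v).trans hv
  have := (abs_le.1 this).2
  simp; linarith

lemma den_pos {w : ℝ} (h1 : w < 1) (h0 : 0 ≤ w) (θ : ℝ) :
    (1 - w) ^ 2 ≤ 1 - 2 * w * Real.cos θ + w ^ 2 := by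
  nlinarith [Real.cos_le_one θ]

lemma cauchy {q s w : ℝ} (hs : 1 < s) (h0 : 0 ≤ w) (h1 : w < 1) :
    ∫ θ in (0 : ℝ)..(2 * Real.pi),
      (((1 - 2 * w * Real.cos θ + w ^ 2)⁻¹ : ℝ) : ℂ) * g q s (exp (θ * I)) =
      (2 * Real.pi * ((s - w) ^ q / (1 - w)) : ℝ) := by
  have hd : DifferentiableOn ℂ (fun v : ℂ => g q s v / (1 - w * v)) (Metric.closedBall 0 1) := by
    intro v hv
    have hv' : ‖v‖ ≤ 1 := by simpa using hv
    apply DifferentiableAt.differentiableWithinAt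
    have hne : (1 : ℂ) - w * v ≠ 0 := by
      intro h
      have h2 : ‖(w : ℂ) * v‖ = 1 := by
        rw [← sub_eq_zero.1 h]; simp
      rw [norm_mul, Complex.norm_real, Real.norm_of_nonneg h0] at h2
      nlinarith [norm_nonneg v]
    unfold g
    refine DifferentiableAt.div ?_ (by fun_prop) hne
    refine DifferentiableAt.mul ?_ (by fun_prop)
    exact DifferentiableAt.cpow (by fun_prop) (by fun_prop) (slit hs hv')
  have hw : (w : ℂ) ∈ Metric.ball (0 : ℂ) 1 := by
    simp [abs_of_nonneg h0, h1]
  have h := hd.circleIntegral_sub_inv_smul hw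
  have hI : (∮ z in C(0, 1), (z - (w : ℂ))⁻¹ • (g q s z / (1 - w * z))) =
      I * ∫ θ in (0 : ℝ)..(2 * Real.pi),
      (((1 - 2 * w * Real.cos θ + w ^ 2)⁻¹ : ℝ) : ℂ) * g q s (exp (θ * I)) := by
    rw [circleIntegral, ← intervalIntegral.integral_const_mul]
    congr 1
    ext θ
    have hp := den_pos h1 h0 θ
    have hp' : 1 - 2 * w * Real.cos θ + w ^ 2 ≠ 0 := by
      have : 0 < (1 - w) ^ 2 := by have : 0 < 1 - w := by linarith
                                   positivity
      linarith
    simp only [deriv_circleMap, circleMap, smul_eq_mul]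
    simp only [ofReal_one, one_mul, zero_add]
    set v := exp (θ * I) with hv
    have key : v * (((1 - 2 * w * Real.cos θ + w ^ 2) : ℝ) : ℂ) = (v - w) * (1 - w * v) := by
      have : v * exp (-(θ * I)) = 1 := by rw [hv, ← Complex.exp_add]; simp
      have h2 : (2 : ℂ) * Complex.cos θ = v + exp (-(θ * I)) := by
        rw [Complex.cos, hv]; ring_nf
      push_cast
      linear_combination (-w * v) * h2 + (-w : ℂ) * this
    have hv0 : v ≠ 0 := Complex.exp_ne_zero _
    have hk : (v - w) * (1 - w * v) ≠ 0 := by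
      rw [← key]; exact mul_ne_zero hv0 (by exact_mod_cast hp')
    have ha := left_ne_zero_of_mul hk
    have hb := right_ne_zero_of_mul hk
    have hc : (((1 - 2 * w * Real.cos θ + w ^ 2) : ℝ) : ℂ) ≠ 0 := by exact_mod_cast hp'
    rw [ofReal_inv]
    generalize (((1 - 2 * w * Real.cos θ + w ^ 2) : ℝ) : ℂ) = D at *
    generalize (1 : ℂ) - w * v = B at *
    generalize v - (w : ℂ) = A at *
    field_simp
    linear_combination (g q s v) * key
  rw [hI] at h
  have h' : I * ∫ θ in (0 : ℝ)..(2 * Real.pi),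
      (((1 - 2 * w * Real.cos θ + w ^ 2)⁻¹ : ℝ) : ℂ) * g q s (exp (θ * I)) =
      I * (2 * Real.pi * ((s - w) ^ q / (1 - w)) : ℝ) := by
    rw [h]
    have hsw : 0 ≤ s - w := by linarith
    have e1 : (1 : ℂ) - w ≠ 0 := by
      have : (1 - w : ℝ) ≠ 0 := by linarith
      exact_mod_cast this
    have e2 : (1 : ℂ) + w ≠ 0 := by
      have : (1 + w : ℝ) ≠ 0 := by linarith
      exact_mod_cast this
    have e3 : (1 : ℂ) - w * w = (1 - w) * (1 + w) := by ring
    push_cast [g, smul_eq_mul, Complex.ofReal_cpow hsw]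
    rw [e3]
    field_simp
  exact mul_left_cancel₀ I_ne_zero h'

lemma cont {q s w : ℝ} (hs : 1 < s) (h0 : 0 ≤ w) (h1 : w < 1) :
    Continuous (fun θ : ℝ => (((1 - 2 * w * Real.cos θ + w ^ 2)⁻¹ : ℝ) : ℂ) * g q s (exp (θ * I))) := by
  unfold g
  refine Continuous.mul ?_ (Continuous.mul ?_ (by fun_prop))
  · refine continuous_ofReal.comp (Continuous.inv₀ (by fun_prop) fun θ => ?_)
    have hp := den_pos h1 h0 θ
    have : 0 < (1 - w) ^ 2 := by have : 0 < 1 - w := by linarith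
                                 positivity
    linarith
  · refine Continuous.cpow (by fun_prop) (by fun_prop) fun θ => slit hs ?_
    simp [Complex.norm_exp_ofReal_mul_I]

lemma gsymm {q s : ℝ} (hs : 1 < s) (θ : ℝ) :
    (g q s (exp (((2 * Real.pi - θ : ℝ) : ℂ) * I))).re = (g q s (exp (θ * I))).re := by
  have : exp (((2 * Real.pi - θ : ℝ) : ℂ) * I) = (starRingEnd ℂ) (exp (θ * I)) := by
    rw [← Complex.exp_conj]
    push_cast
    rw [sub_mul, Complex.exp_sub, Complex.exp_two_pi_mul_I, map_mul, conj_I, conj_ofReal, mul_neg,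
      Complex.exp_neg, one_div]
  rw [this]
  have h2 : g q s ((starRingEnd ℂ) (exp (θ * I))) = (starRingEnd ℂ) (g q s (exp (θ * I))) := by
    unfold g
    have hsl := slit hs (v := exp (θ * I)) (by simp [Complex.norm_exp_ofReal_mul_I])
    have := Complex.conj_cpow _ (q : ℂ) (Complex.mem_slitPlane_iff_arg.1 hsl).1
    rw [conj_ofReal, map_sub, conj_ofReal] at this
    rw [this, map_mul, map_add, map_one]
  rw [h2, conj_re]

lemma half {q s w : ℝ} (hs : 1 < s) (h0 : 0 ≤ w) (h1 : w < 1) :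
    ∫ θ in (0 : ℝ)..Real.pi,
      (1 - 2 * w * Real.cos θ + w ^ 2)⁻¹ * (g q s (exp (θ * I))).re =
      Real.pi * ((s - w) ^ q / (1 - w)) := by
  have hc := cont (q := q) hs h0 h1
  have hcr := Complex.continuous_re.comp hc
  have h := congrArg Complex.re (cauchy (q := q) hs h0 h1)
  have h3 := Complex.reCLM.intervalIntegral_comp_comm (hc.intervalIntegrable (μ := volume) 0 (2 * Real.pi))
  simp only [Complex.reCLM_apply] at h3
  rw [← h3, ofReal_re] at h
  simp only [re_ofReal_mul] at h
  have hcr' : Continuous fun θ : ℝ => (1 - 2 * w * Real.cos θ + w ^ 2)⁻¹ * (g q s (exp (θ * I))).re := by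
    refine hcr.congr fun θ => ?_
    simp only [Function.comp, re_ofReal_mul]
  rw [← intervalIntegral.integral_add_adjacent_intervals (hcr'.intervalIntegrable 0 Real.pi)
    (hcr'.intervalIntegrable _ _)] at h
  have h4 := intervalIntegral.integral_comp_sub_left (a := 0) (b := Real.pi)
    (fun θ : ℝ => (1 - 2 * w * Real.cos θ + w ^ 2)⁻¹ * (g q s (exp (θ * I))).re) (2 * Real.pi)
  have e1 : 2 * Real.pi - Real.pi = Real.pi := by ring
  rw [e1, sub_zero] at h4
  rw [← h4] at h
  simp only [gsymm hs, Real.cos_two_pi_sub] at h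
  linarith

lemma lower {s θ : ℝ} (hs : 1 ≤ s) (h0 : 0 ≤ θ) (hp : θ ≤ Real.pi) :
    2 / Real.pi * θ ≤ ‖(s : ℂ) - exp (θ * I)‖ := by
  have h := Real.mul_le_sin (x := θ / 2) (by linarith) (by linarith)
  have hpos := Real.pi_pos
  have h0' : 0 ≤ 2 / Real.pi * (θ / 2) := by positivity
  have hsq : ‖(s : ℂ) - exp (θ * I)‖ ^ 2 = (s - Real.cos θ) ^ 2 + Real.sin θ ^ 2 := by
    rw [← Complex.normSq_eq_norm_sq, Complex.normSq_apply, sub_re, sub_im,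
      Complex.exp_ofReal_mul_I_re, Complex.exp_ofReal_mul_I_im, ofReal_re, ofReal_im]
    ring
  refine (sq_le_sq₀ (by positivity) (norm_nonneg _)).1 ?_
  rw [hsq]
  have hcos : Real.cos θ = 1 - 2 * Real.sin (θ / 2) ^ 2 := by
    have := Real.cos_sq' (θ / 2)
    have h2 := Real.cos_two_mul (θ / 2)
    rw [show 2 * (θ / 2) = θ by ring] at h2
    linarith
  have h5 : (2 / Real.pi * θ) ^ 2 ≤ 4 * Real.sin (θ / 2) ^ 2 := by
    nlinarith
  nlinarith [Real.sin_sq_add_cos_sq θ, Real.cos_le_one θ]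

lemma limit {q w : ℝ} (hq : -1 < q) (hq1 : q < 1) (h0 : 0 ≤ w) (h1 : w < 1) :
    ∫ θ in (0 : ℝ)..Real.pi,
      (1 - 2 * w * Real.cos θ + w ^ 2)⁻¹ * (g q 1 (exp (θ * I))).re =
      Real.pi * ((1 - w) ^ q / (1 - w)) := by
  have hpos := Real.pi_pos
  have hT := intervalIntegral.tendsto_integral_filter_of_dominated_convergence
    (a := 0) (b := Real.pi) (μ := volume) (l := 𝓝[>] (1 : ℝ))
    (F := fun s θ => (1 - 2 * w * Real.cos θ + w ^ 2)⁻¹ * (g q s (exp (θ * I))).re)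
    (f := fun θ => (1 - 2 * w * Real.cos θ + w ^ 2)⁻¹ * (g q 1 (exp (θ * I))).re)
    (fun θ => ((1 - w) ^ 2)⁻¹ * ((3 + (2 / Real.pi) ^ q * θ ^ q) * 2)) ?_ ?_ ?_ ?_
  · have hT2 : Tendsto (fun s : ℝ => Real.pi * ((s - w) ^ q / (1 - w))) (𝓝[>] (1 : ℝ))
        (𝓝 (Real.pi * ((1 - w) ^ q / (1 - w)))) := by
      have : ContinuousAt (fun s : ℝ => Real.pi * ((s - w) ^ q / (1 - w))) 1 := by
        refine ContinuousAt.mul (by fun_prop) (ContinuousAt.div_const ?_ _)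
        exact ContinuousAt.rpow_const (by fun_prop) (Or.inl (by linarith))
      exact this.tendsto.mono_left nhdsWithin_le_nhds
    refine tendsto_nhds_unique (hT.congr' ?_) hT2
    filter_upwards [self_mem_nhdsWithin] with s hs
    exact half hs h0 h1
  · filter_upwards [self_mem_nhdsWithin] with s hs
    have hcr := Complex.continuous_re.comp (cont (q := q) hs h0 h1)
    refine Continuous.aestronglyMeasurable (hcr.congr fun θ => ?_)
    simp only [Function.comp, re_ofReal_mul]
  · filter_upwards [Ioo_mem_nhdsGT (show (1 : ℝ) < 2 by norm_num)] with s hs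
    refine Eventually.of_forall fun θ hθ => ?_
    rw [uIoc_of_le hpos.le] at hθ
    have hw2 : 0 < (1 - w) ^ 2 := by
      have : 0 < 1 - w := by linarith
      positivity
    have hd := den_pos h1 h0 θ
    have hlow := lower hs.1.le hθ.1.le hθ.2
    have hθ0 := hθ.1
    have hlp : 0 < 2 / Real.pi * θ := by positivity
    have hup : ‖(s : ℂ) - exp (θ * I)‖ ≤ 3 := by
      refine (norm_sub_le _ _).trans ?_
      rw [Complex.norm_exp_ofReal_mul_I, Complex.norm_real, Real.norm_of_nonneg (by linarith [hs.1])]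
      linarith [hs.2]
    have hcp : ‖(s : ℂ) - exp (θ * I)‖ ^ q ≤ 3 + (2 / Real.pi) ^ q * θ ^ q := by
      rw [← Real.mul_rpow (by positivity) hθ0.le]
      rcases le_total 0 q with h | h
      · have a1 := Real.rpow_le_rpow (norm_nonneg _) hup h
        have a2 : (3 : ℝ) ^ q ≤ 3 ^ (1 : ℝ) := Real.rpow_le_rpow_of_exponent_le (by norm_num) hq1.le
        rw [Real.rpow_one] at a2
        have a3 : 0 ≤ (2 / Real.pi * θ) ^ q := by positivity
        linarith
      · have a1 := Real.rpow_le_rpow_of_nonpos hlp hlow h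
        linarith
    rw [norm_mul, norm_inv, Real.norm_of_nonneg (by linarith)]
    refine mul_le_mul (inv_anti₀ hw2 hd) ?_ (norm_nonneg _) (by positivity)
    rw [Real.norm_eq_abs]
    refine (Complex.abs_re_le_norm _).trans ?_
    rw [g, norm_mul, Complex.norm_cpow_real]
    refine mul_le_mul hcp ?_ (norm_nonneg _) (by positivity)
    refine (norm_add_le _ _).trans ?_
    rw [Complex.norm_exp_ofReal_mul_I]; norm_num
  · have := intervalIntegral.intervalIntegrable_rpow' (a := 0) (b := Real.pi) hq
    exact (((intervalIntegrable_const).add (this.const_mul _)).mul_const _).const_mul _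
  · refine Eventually.of_forall fun θ hθ => ?_
    rw [uIoc_of_le hpos.le] at hθ
    have hθ0 := hθ.1
    refine Tendsto.const_mul _ ((Complex.continuous_re.tendsto _).comp ?_)
    unfold g
    refine Tendsto.mul_const _ ?_
    have hsl : ((1 : ℝ) : ℂ) - exp (θ * I) ∈ slitPlane := by
      left
      rw [sub_re, Complex.exp_ofReal_mul_I_re, ofReal_re]
      have := Real.cos_lt_cos_of_nonneg_of_le_pi le_rfl hθ.2 hθ0
      rw [Real.cos_zero] at this
      linarith
    have : ContinuousAt (fun s : ℝ => ((s : ℂ) - exp (θ * I)) ^ (q : ℂ)) 1 := by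
      refine ContinuousAt.cpow (by fun_prop) (by fun_prop) hsl
    exact this.tendsto.mono_left nhdsWithin_le_nhds

lemma ident {a θ : ℝ} (h0 : 0 < θ) (hp : θ < Real.pi) :
    (g (1 - 2 * a) 1 (exp (θ * I))).re =
      2 * Real.sin θ * (Real.sin ((1 - a) * (Real.pi - θ)) * (2 - 2 * Real.cos θ) ^ (-a)) := by
  have hS : 0 < Real.sin (θ / 2) := Real.sin_pos_of_pos_of_lt_pi (by linarith) (by linarith)
  set S := Real.sin (θ / 2) with hSdef
  set C := Real.cos (θ / 2) with hCdef
  have hsc : S ^ 2 + C ^ 2 = 1 := Real.sin_sq_add_cos_sq _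
  have hcos : Real.cos θ = 1 - 2 * S ^ 2 := by
    have h2 := Real.cos_two_mul (θ / 2)
    rw [show 2 * (θ / 2) = θ by ring] at h2
    rw [h2]; linarith
  have hsin : Real.sin θ = 2 * S * C := by
    have h2 := Real.sin_two_mul (θ / 2)
    rwa [show 2 * (θ / 2) = θ by ring] at h2
  have hE : exp (θ * I) = (Real.cos θ : ℂ) + (Real.sin θ : ℂ) * I := by
    rw [Complex.exp_mul_I, ofReal_cos, ofReal_sin]
  have c1 : Real.cos ((θ - Real.pi) / 2) = S := by
    rw [sub_div, Real.cos_sub_pi_div_two]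
  have c2 : Real.sin ((θ - Real.pi) / 2) = -C := by
    rw [sub_div, Real.sin_sub_pi_div_two]
  have hA : ((1 : ℝ) : ℂ) - exp (θ * I) = ((2 * S : ℝ) : ℂ) *
      (Complex.cos (((θ - Real.pi) / 2 : ℝ) : ℂ) + Complex.sin (((θ - Real.pi) / 2 : ℝ) : ℂ) * I) := by
    rw [← ofReal_cos, ← ofReal_sin, c1, c2, hE, hcos, hsin]
    push_cast; ring
  have hB : 1 + exp (θ * I) = ((2 * C : ℝ) : ℂ) * ((C : ℂ) + (S : ℂ) * I) := by
    rw [hE, hcos, hsin]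
    have : (S : ℂ) ^ 2 + (C : ℂ) ^ 2 = 1 := by exact_mod_cast hsc
    push_cast; linear_combination (-2 : ℂ) * this
  have harg : (((1 : ℝ) : ℂ) - exp (θ * I)).arg = (θ - Real.pi) / 2 := by
    rw [hA]
    exact Complex.arg_mul_cos_add_sin_mul_I (by positivity) ⟨by linarith, by linarith⟩
  have hnorm : ‖((1 : ℝ) : ℂ) - exp (θ * I)‖ = 2 * S := by
    rw [hA, ← Complex.exp_mul_I, norm_mul, Complex.norm_exp_ofReal_mul_I, Complex.norm_real,
      Real.norm_of_nonneg (by positivity), mul_one]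
  have hpw : (2 - 2 * Real.cos θ) ^ (-a) = (2 * S) ^ (-(2 * a)) := by
    rw [hcos, show 2 - 2 * (1 - 2 * S ^ 2) = (2 * S) ^ (2 : ℝ) by rw [Real.rpow_two]; ring,
      ← Real.rpow_mul (by positivity)]
    congr 1; ring
  have hpw2 : (2 * S) ^ (1 - 2 * a) = (2 * S) * (2 * S) ^ (-(2 * a)) := by
    rw [sub_eq_add_neg, Real.rpow_add (by positivity), Real.rpow_one]
  have hang : Real.cos ((θ - Real.pi) / 2 * (1 - 2 * a)) * C - Real.sin ((θ - Real.pi) / 2 * (1 - 2 * a)) * S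
      = Real.sin ((1 - a) * (Real.pi - θ)) := by
    rw [hSdef, hCdef, ← Real.cos_add, ← Real.cos_pi_div_two_sub]
    congr 1; ring
  rw [g, Complex.cpow_ofReal, harg, hnorm, hB, hpw, hpw2, ← hang, hsin]
  generalize Real.cos ((θ - Real.pi) / 2 * (1 - 2 * a)) = X
  generalize Real.sin ((θ - Real.pi) / 2 * (1 - 2 * a)) = Y
  generalize (2 * S) ^ (-(2 * a)) = Z
  simp
  ring

lemma main {a w : ℝ} (ha0 : 0 < a) (ha1 : a < 1) (h0 : 0 ≤ w) (h1 : w < 1) :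
    ∫ x in (-2 : ℝ)..2, (1 - w * x + w ^ 2)⁻¹ *
      (Real.sin ((1 - a) * (Real.arcsin (x / 2) + Real.pi / 2)) * (2 - x) ^ (-a)) =
      Real.pi * (1 - w) ^ (-(2 * a)) := by
  have hpos := Real.pi_pos
  have himg : (fun θ => 2 * Real.cos θ) '' Ioo 0 Real.pi = Ioo (-2) 2 := by
    ext x
    constructor
    · rintro ⟨θ, hθ, rfl⟩
      have l1 := Real.cos_lt_cos_of_nonneg_of_le_pi le_rfl hθ.2.le hθ.1
      have l2 := Real.cos_lt_cos_of_nonneg_of_le_pi hθ.1.le le_rfl hθ.2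
      rw [Real.cos_zero] at l1
      rw [Real.cos_pi] at l2
      constructor <;> simp only <;> linarith
    · rintro ⟨l1, l2⟩
      refine ⟨Real.arccos (x / 2), ⟨Real.arccos_pos.2 (by linarith), ?_⟩, ?_⟩
      · refine lt_of_le_of_ne (Real.arccos_le_pi _) fun h => ?_
        rw [Real.arccos_eq_pi] at h
        linarith
      · simp only
        rw [Real.cos_arccos (by linarith) (by linarith)]; ring
  have hinj : InjOn (fun θ => 2 * Real.cos θ) (Ioo 0 Real.pi) := by
    intro x hx y hy h
    exact Real.injOn_cos ⟨hx.1.le, hx.2.le⟩ ⟨hy.1.le, hy.2.le⟩ (by simpa using h)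
  rw [intervalIntegral.integral_of_le (by norm_num), integral_Ioc_eq_integral_Ioo, ← himg,
    integral_image_eq_integral_abs_deriv_smul (f' := fun θ => 2 * -Real.sin θ) measurableSet_Ioo
      (fun θ _ => ((Real.hasDerivAt_cos θ).const_mul 2).hasDerivWithinAt) hinj]
  have hL := limit (q := 1 - 2 * a) (w := w) (by linarith) (by linarith) h0 h1
  rw [intervalIntegral.integral_of_le hpos.le, integral_Ioc_eq_integral_Ioo] at hL
  have hr : (1 - w) ^ (1 - 2 * a) / (1 - w) = (1 - w) ^ (-(2 * a)) := by
    have : 0 < 1 - w := by linarith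
    rw [sub_eq_add_neg 1 (2 * a), Real.rpow_add this, Real.rpow_one]
    field_simp
  rw [← hr, ← hL]
  refine setIntegral_congr_fun measurableSet_Ioo fun θ hθ => ?_
  beta_reduce
  have hsin := Real.sin_pos_of_pos_of_lt_pi hθ.1 hθ.2
  have harc : Real.arcsin (2 * Real.cos θ / 2) + Real.pi / 2 = Real.pi - θ := by
    rw [mul_div_cancel_left₀ _ (by norm_num : (2 : ℝ) ≠ 0), Real.arcsin_eq_pi_div_two_sub_arccos,
      Real.arccos_cos hθ.1.le hθ.2.le]
    ring
  rw [ident hθ.1 hθ.2, harc, mul_neg, abs_neg, abs_of_pos (by positivity), smul_eq_mul]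
  rw [show w * (2 * Real.cos θ) = 2 * w * Real.cos θ by ring]
  ring

end S16

theorem stmt_16 (l : ℝ) (hl : 1 / 2 < l) :
    ∃ c : ℝ, 0 < c ∧
      c = ∫ x in (-2 : ℝ)..2,
            Real.sin ((1 - 1 / (2 * l)) * (Real.arcsin (x / 2) + Real.pi / 2)) *
              (2 - x) ^ (-(1 / (2 * l))) ∧
      ∀ z : ℝ, 2 < z →
        ∫ x in (-2 : ℝ)..2, (z - x)⁻¹ *
            Real.sin ((1 - 1 / (2 * l)) * (Real.arcsin (x / 2) + Real.pi / 2)) *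
              (2 - x) ^ (-(1 / (2 * l))) =
          c * ((z - Real.sqrt (z ^ 2 - 4)) / 2) ^ (1 - 1 / (2 * l)) *
            (z - 2) ^ (-(1 / (2 * l))) := by
  have ha0 : 0 < 1 / (2 * l) := by
    have : 0 < l := by linarith
    positivity
  have ha1 : 1 / (2 * l) < 1 := by
    rw [div_lt_one (by linarith)]; linarith
  generalize 1 / (2 * l) = a at *
  refine ⟨Real.pi, Real.pi_pos, ?_, fun z hz => ?_⟩
  · have := S16.main ha0 ha1 le_rfl zero_lt_one
    simpa using this.symm
  · have hsq : Real.sqrt (z ^ 2 - 4) ^ 2 = z ^ 2 - 4 := Real.sq_sqrt (by nlinarith)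
    have hs0 := Real.sqrt_nonneg (z ^ 2 - 4)
    set r := Real.sqrt (z ^ 2 - 4)
    set w := (z - r) / 2 with hw
    have hrel : w ^ 2 + 1 = z * w := by rw [hw]; nlinarith
    have hw0 : 0 < w := by
      have : r < z := by nlinarith
      rw [hw]; linarith
    have hw1 : w < 1 := by
      have : z - 2 < r := by nlinarith
      rw [hw]; linarith
    have hm := S16.main ha0 ha1 hw0.le hw1
    have hz2 : z - 2 = (1 - w) ^ (2 : ℝ) * w⁻¹ := by
      rw [Real.rpow_two]; field_simp; linarith
    have hp : (z - 2) ^ (-a) = (1 - w) ^ (-(2 * a)) * w ^ a := by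
      have : 0 ≤ 1 - w := by linarith
      rw [hz2, Real.mul_rpow (by positivity) (by positivity), ← Real.rpow_mul this,
        Real.inv_rpow hw0.le, Real.rpow_neg hw0.le, inv_inv]
      congr 2; ring
    have hww : w ^ (1 - a) * w ^ a = w := by
      rw [← Real.rpow_add hw0]; simp
    have : Real.pi * w ^ (1 - a) * (z - 2) ^ (-a) = w * (Real.pi * (1 - w) ^ (-(2 * a))) := by
      rw [hp]; linear_combination (Real.pi * (1 - w) ^ (-(2 * a))) * hww
    rw [this, ← hm, ← intervalIntegral.integral_const_mul]
    congr 1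
    ext x
    have : 1 - w * x + w ^ 2 = w * (z - x) := by linarith
    rw [this, mul_inv]
    field_simp
end
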